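/- Averaging interpretation of the discrete wedge product (first form): let X be an abstract simplicial complex, α ∈ C^k(X), β ∈ C^l(X), and σ a (k+l)-simplex in X. Then (α ∧ β)(σ) = (1 / C(k+l+1, k+1)) · Σ_{f a k-face of σ} α(f) · ( (1/(k+1)) Σ_{v a vertex of f} β(v ∗ (σ∖f)) ), where the sum is over all k-dimensional faces f of σ and, inside, over all vertices v of f; here σ∖f is the face of σ spanned by the vertices of σ not in f, v ∗ (σ∖f) is the simplex spanned by v together with the vertices of σ∖f, and the orientations of f and v ∗ (σ∖f) are chosen so that the vertex ordering (f∖{v}, v, σ∖f) corresponds to an even permutation of the chosen ordering of σ in S_{k+l+1}. -/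

import Mathlib

open Finset
open scoped Classical

/-- An abstract simplicial complex on a vertex type `V`: a downward-closed
family of nonempty finite sets of vertices. -/
structure ASC (V : Type*) where
  faces : Set (Finset V)
  nonempty_of_mem : ∀ s ∈ faces, s.Nonempty
  down_closed : ∀ s ∈ faces, ∀ t ⊆ s, t.Nonempty → t ∈ faces

variable {V W : Type*} [DecidableEq V] [DecidableEq W]

/-- `v` is an ordered `k`-simplex of `X`: an injective tuple of vertices spanning a face. -/
def IsSimplex (X : ASC V) (k : ℕ) (v : Fin (k + 1) → V) : Prop :=
  Function.Injective v ∧ Finset.image v Finset.univ ∈ X.faces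

/-- A (raw) `k`-cochain is alternating: permuting the vertices changes the value by
the sign of the permutation. -/
def IsAlternating (k : ℕ) (α : (Fin (k + 1) → V) → ℝ) : Prop :=
  ∀ (v : Fin (k + 1) → V) (τ : Equiv.Perm (Fin (k + 1))),
    α (v ∘ τ) = ((Equiv.Perm.sign τ : ℤ) : ℝ) * α v

/-- The coboundary (discrete exterior derivative) of a `k`-cochain. -/
noncomputable def coboundary (k : ℕ) (α : (Fin (k + 1) → V) → ℝ) :
    (Fin (k + 2) → V) → ℝ :=
  fun v => ∑ i : Fin (k + 2), (-1 : ℝ) ^ (i : ℕ) * α (v ∘ i.succAbove)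

/-- An abstract simplicial map: a vertex map carrying faces of `X` to faces of `Y`. -/
def IsSimplicialMap (X : ASC V) (Y : ASC W) (f : V → W) : Prop :=
  ∀ s ∈ X.faces, s.image f ∈ Y.faces

/-- Pullback of a `k`-cochain along a vertex map: `(f*α)(c) = α(f♯ c)`, where
`f♯` sends a tuple with distinct images to its image tuple and to `0` otherwise. -/
noncomputable def pullback (f : V → W) (k : ℕ) (α : (Fin (k + 1) → W) → ℝ) :
    (Fin (k + 1) → V) → ℝ :=
  fun v => if Function.Injective (f ∘ v) then α (f ∘ v) else 0

/-- The cup product of a `k`-cochain and an `l`-cochain. -/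
noncomputable def cup (k l : ℕ) (α : (Fin (k + 1) → V) → ℝ) (β : (Fin (l + 1) → V) → ℝ) :
    (Fin (k + l + 1) → V) → ℝ :=
  fun v => α (fun i => v ⟨(i : ℕ), by have := i.isLt; omega⟩) *
    β (fun i => v ⟨k + (i : ℕ), by have := i.isLt; omega⟩)

/-- The discrete (DEC) wedge product: the antisymmetrized cup product. -/
noncomputable def wedge (k l : ℕ) (α : (Fin (k + 1) → V) → ℝ) (β : (Fin (l + 1) → V) → ℝ) :
    (Fin (k + l + 1) → V) → ℝ :=
  fun v => (1 / (Nat.factorial (k + l + 1) : ℝ)) *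
    ∑ τ : Equiv.Perm (Fin (k + l + 1)),
      ((Equiv.Perm.sign τ : ℤ) : ℝ) * cup k l α β (v ∘ τ)

lemma lt_add_add_one (k l : ℕ) : k < k + l + 1 := by omega

/-- A permutation of `Fin (k + l + 1)` fixing `k` and preserving `{i | i ≤ k}` restricts to
permutations of the front and back blocks, and its sign is the product of their signs. -/
lemma exists_block_perms {k l : ℕ} (π : Equiv.Perm (Fin (k + l + 1)))
    (hk : π ⟨k, lt_add_add_one k l⟩ = ⟨k, lt_add_add_one k l⟩)
    (hle : ∀ i : Fin (k + l + 1), (i : ℕ) ≤ k ↔ (π i : ℕ) ≤ k) :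
    ∃ (s : Equiv.Perm (Fin (k + 1))) (t : Equiv.Perm (Fin (l + 1))),
      (∀ i : Fin (k + 1), π ⟨(i : ℕ), by omega⟩ = ⟨(s i : ℕ), by omega⟩) ∧
      (∀ j : Fin (l + 1), π ⟨k + (j : ℕ), by omega⟩ = ⟨k + (t j : ℕ), by omega⟩) ∧
      Equiv.Perm.sign π = Equiv.Perm.sign s * Equiv.Perm.sign t := by
  have hge : ∀ i : Fin (k + l + 1), k ≤ (i : ℕ) → k ≤ (π i : ℕ) := by
    intro i hi
    by_cases h : (i : ℕ) = k
    · have : i = ⟨k, lt_add_add_one k l⟩ := Fin.ext h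
      rw [this, hk]
    · have := hle i
      omega
  have hs : ∀ i : Fin (k + 1), ∃ j : Fin (k + 1), π ⟨(i : ℕ), by omega⟩ = ⟨(j : ℕ), by omega⟩ :=
    fun i => ⟨⟨_, Nat.lt_succ_of_le ((hle ⟨i, by omega⟩).1 (Nat.le_of_lt_succ i.isLt))⟩, rfl⟩
  have ht : ∀ i : Fin (l + 1), ∃ j : Fin (l + 1),
      π ⟨k + (i : ℕ), by omega⟩ = ⟨k + (j : ℕ), by omega⟩ := by
    intro i
    have h := hge ⟨k + i, by omega⟩ (by simp)
    refine ⟨⟨(π ⟨k + i, by omega⟩ : ℕ) - k, by omega⟩, Fin.ext ?_⟩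
    simp only
    omega
  choose s hs using hs
  choose t ht using ht
  have hsi : Function.Injective s := by
    intro i j h
    have := π.injective ((hs i).trans ((congrArg (fun x : Fin (k + 1) =>
      (⟨(x : ℕ), by omega⟩ : Fin (k + l + 1))) h).trans (hs j).symm))
    simpa [Fin.ext_iff] using this
  have hti : Function.Injective t := by
    intro i j h
    have := π.injective ((ht i).trans ((congrArg (fun x : Fin (l + 1) =>
      (⟨k + (x : ℕ), by omega⟩ : Fin (k + l + 1))) h).trans (ht j).symm))
    simpa [Fin.ext_iff] using this
  let s' : Equiv.Perm (Fin (k + 1)) :=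
    Equiv.ofBijective s (Finite.injective_iff_bijective.1 hsi)
  let t' : Equiv.Perm (Fin (l + 1)) :=
    Equiv.ofBijective t (Finite.injective_iff_bijective.1 hti)
  let e₁ : Fin (k + 1) ↪ Fin (k + l + 1) :=
    ⟨fun i => ⟨(i : ℕ), by omega⟩, fun i j h => by simpa [Fin.ext_iff] using h⟩
  let e₂ : Fin (l + 1) ↪ Fin (k + l + 1) :=
    ⟨fun i => ⟨k + (i : ℕ), by omega⟩, fun i j h => by simpa [Fin.ext_iff] using h⟩
  have he₁ : ∀ i, (e₁ i : ℕ) = i := fun _ => rfl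
  have he₂ : ∀ i, (e₂ i : ℕ) = k + i := fun _ => rfl
  have hs' : ∀ i, π (e₁ i) = e₁ (s' i) := hs
  have ht' : ∀ i, π (e₂ i) = e₂ (t' i) := ht
  have hlast : e₁ (Fin.last k) = e₂ 0 := Fin.ext (by rw [he₁, he₂]; simp)
  have hk' : π (e₁ (Fin.last k)) = e₁ (Fin.last k) := hk
  refine ⟨s', t', hs, ht, ?_⟩
  have key : π = s'.viaFintypeEmbedding e₁ * t'.viaFintypeEmbedding e₂ := by
    ext1 x
    rw [Equiv.Perm.mul_apply]
    by_cases hx : (x : ℕ) < k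
    · have h2 : x ∉ Set.range e₂ := by
        rintro ⟨j, rfl⟩
        rw [he₂] at hx
        omega
      obtain ⟨i, rfl⟩ : ∃ i, e₁ i = x := ⟨⟨x, by omega⟩, rfl⟩
      rw [Equiv.Perm.viaFintypeEmbedding_apply_notMem_range _ _ h2,
        Equiv.Perm.viaFintypeEmbedding_apply_image, hs']
    · obtain ⟨j, rfl⟩ : ∃ j, e₂ j = x :=
        ⟨⟨(x : ℕ) - k, by omega⟩, Fin.ext (by rw [he₂]; simp only; omega)⟩
      rw [Equiv.Perm.viaFintypeEmbedding_apply_image, ht']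
      by_cases hj : t' j = 0
      · rw [hj, ← hlast, Equiv.Perm.viaFintypeEmbedding_apply_image, ← hs', hk']
      · have h1 : e₂ (t' j) ∉ Set.range e₁ := by
          rintro ⟨i, hi⟩
          apply hj
          have := congrArg Fin.val hi
          rw [he₁, he₂] at this
          apply Fin.ext
          simp only [Fin.val_zero]
          omega
        rw [Equiv.Perm.viaFintypeEmbedding_apply_notMem_range _ _ h1]
  rw [key, Equiv.Perm.sign_mul, Equiv.Perm.viaFintypeEmbedding_sign,
    Equiv.Perm.viaFintypeEmbedding_sign]

/-- The front positions `{i | i ≤ k}` and the shared position `k`, moved by a permutation. -/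
def frontFlag (k l : ℕ) (τ : Equiv.Perm (Fin (k + l + 1))) :
    (_ : Finset (Fin (k + l + 1))) × Fin (k + l + 1) :=
  ⟨(Finset.Iic ⟨k, lt_add_add_one k l⟩).map τ.toEmbedding, τ ⟨k, lt_add_add_one k l⟩⟩

lemma frontFlag_eq_iff {k l : ℕ} (τ ρ : Equiv.Perm (Fin (k + l + 1))) :
    frontFlag k l τ = frontFlag k l ρ ↔
      (ρ⁻¹ * τ) ⟨k, lt_add_add_one k l⟩ = ⟨k, lt_add_add_one k l⟩ ∧
      ∀ i : Fin (k + l + 1), (i : ℕ) ≤ k ↔ ((ρ⁻¹ * τ) i : ℕ) ≤ k := by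
  simp only [frontFlag, Sigma.mk.injEq, heq_eq_eq, Finset.ext_iff, Finset.mem_map_equiv,
    Finset.mem_Iic, Fin.le_def, Equiv.Perm.mul_apply, Equiv.Perm.inv_eq_iff_eq]
  rw [and_comm]
  refine and_congr_right fun _ => ⟨fun h i => ?_, fun h i => ?_⟩
  · simpa using h (τ i)
  · simpa using h (τ.symm i)

lemma card_frontFlag_fiber {k l : ℕ} (ρ ρ' : Equiv.Perm (Fin (k + l + 1))) :
    (Finset.univ.filter fun τ => frontFlag k l τ = frontFlag k l ρ).card =
      (Finset.univ.filter fun τ => frontFlag k l τ = frontFlag k l ρ').card := by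
  refine Finset.card_equiv (Equiv.mulLeft (ρ' * ρ⁻¹)) fun τ => ?_
  simp [frontFlag_eq_iff]

lemma frontFlag_mem {k l : ℕ} (τ : Equiv.Perm (Fin (k + l + 1))) :
    frontFlag k l τ ∈ (Finset.powersetCard (k + 1)
      (Finset.univ : Finset (Fin (k + l + 1)))).sigma fun F => F := by
  simp [frontFlag, Finset.mem_powersetCard]

/-- The signed cup product of an ordering depends only on its front flag. -/
lemma sign_mul_cup_eq_of_frontFlag_eq {V : Type*} {k l : ℕ}
    {α : (Fin (k + 1) → V) → ℝ} (hα : IsAlternating k α)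
    {β : (Fin (l + 1) → V) → ℝ} (hβ : IsAlternating l β)
    (σ : Fin (k + l + 1) → V) {τ ρ : Equiv.Perm (Fin (k + l + 1))}
    (h : frontFlag k l τ = frontFlag k l ρ) :
    ((Equiv.Perm.sign τ : ℤ) : ℝ) * cup k l α β (σ ∘ τ) =
      ((Equiv.Perm.sign ρ : ℤ) : ℝ) * cup k l α β (σ ∘ ρ) := by
  obtain ⟨h₁, h₂⟩ := (frontFlag_eq_iff τ ρ).1 h
  obtain ⟨s, t, hs, ht, hsign⟩ := exists_block_perms _ h₁ h₂
  obtain ⟨π, rfl⟩ : ∃ π, τ = ρ * π := ⟨ρ⁻¹ * τ, by simp⟩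
  simp only [inv_mul_cancel_left] at hs ht hsign
  have e₁ := hα (fun i => σ (ρ ⟨(i : ℕ), by omega⟩)) s
  have e₂ := hβ (fun i => σ (ρ ⟨k + (i : ℕ), by omega⟩)) t
  simp only [Function.comp_def] at e₁ e₂
  simp only [cup, Function.comp_apply, Equiv.Perm.mul_apply, hs, ht, e₁, e₂,
    Equiv.Perm.sign_mul, hsign]
  rcases Int.units_eq_one_or (Equiv.Perm.sign s) with h₁ | h₁ <;>
    rcases Int.units_eq_one_or (Equiv.Perm.sign t) with h₂ | h₂ <;> simp [h₁, h₂]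

/-- The signed cup product expressed through compatibly oriented orderings of both blocks. -/
lemma sign_mul_cup_eq_of_compat {V : Type*} {k l : ℕ}
    {α : (Fin (k + 1) → V) → ℝ} (hα : IsAlternating k α)
    {β : (Fin (l + 1) → V) → ℝ} (hβ : IsAlternating l β)
    (σ : Fin (k + l + 1) → V) {ρ : Equiv.Perm (Fin (k + l + 1))}
    {a : Fin (k + 1) → Fin (k + l + 1)} {c : Fin (l + 1) → Fin (k + l + 1)}
    {s : Equiv.Perm (Fin (k + 1))} {t : Equiv.Perm (Fin (l + 1))}
    (hs : ∀ i : Fin (k + 1), ρ ⟨(i : ℕ), by omega⟩ = a (s i))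
    (ht : ∀ j : Fin (l + 1), ρ ⟨k + (j : ℕ), by omega⟩ = c (t j))
    (hsign : Equiv.Perm.sign ρ * Equiv.Perm.sign s * Equiv.Perm.sign t = 1) :
    ((Equiv.Perm.sign ρ : ℤ) : ℝ) * cup k l α β (σ ∘ ρ) = α (σ ∘ a) * β (σ ∘ c) := by
  have e₁ := hα (σ ∘ a) s
  have e₂ := hβ (σ ∘ c) t
  simp only [Function.comp_def] at e₁ e₂
  simp only [cup, Function.comp_def, hs, ht, e₁, e₂]
  have h : ((Equiv.Perm.sign ρ : ℤ) : ℝ) * ((Equiv.Perm.sign s : ℤ) : ℝ) *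
      ((Equiv.Perm.sign t : ℤ) : ℝ) = 1 := by
    have := congrArg (fun u : ℤˣ => ((u : ℤ) : ℝ)) hsign
    push_cast at this
    exact this
  linear_combination (α (fun i => σ (a i)) * β (fun i => σ (c i))) * h

/-- **Averaging interpretation of the discrete wedge product (first form).**
For cochains `α ∈ Cᵏ(X)`, `β ∈ Cˡ(X)` and a `(k+l)`-simplex `σ` of `X`,
`(α ∧ β)(σ) = (1/C(k+l+1,k+1)) Σ_{f a k-face of σ} α(f) · ((1/(k+1)) Σ_{v ∈ f} β(v ∗ (σ∖f)))`.
A `k`-face `f` of `σ` is encoded by the set `F` of its positions in `σ`; its chosen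
orientation is an injective ordering `a F` of `F`, and the chosen orientation of
`v ∗ (σ∖f)` is an injective ordering `c F v` of `{v} ∪ (σ∖F)`.  The hypothesis
`hcompat` says these orientations are chosen so that the vertex ordering
`(f∖{v}, v, σ∖f)` (a permutation `ρ` placing `v` at position `k`, whose first
`k+1` entries are an `s`-rearrangement of `a F` and whose last `l+1` entries are
an `s'`-rearrangement of `c F v`) corresponds to an even permutation:
`sgn ρ · sgn s · sgn s' = 1`. -/
theorem wedge_averaging_first_form {V : Type*} [DecidableEq V] (X : ASC V) (k l : ℕ)
    (α : (Fin (k + 1) → V) → ℝ) (hα : IsAlternating k α)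
    (β : (Fin (l + 1) → V) → ℝ) (hβ : IsAlternating l β)
    (σ : Fin (k + l + 1) → V) (hσ : IsSimplex X (k + l) σ)
    (a : Finset (Fin (k + l + 1)) → Fin (k + 1) → Fin (k + l + 1))
    (c : Finset (Fin (k + l + 1)) → Fin (k + l + 1) → Fin (l + 1) → Fin (k + l + 1))
    (ha : ∀ F ∈ Finset.powersetCard (k + 1) (Finset.univ : Finset (Fin (k + l + 1))),
      Function.Injective (a F) ∧ ∀ i, a F i ∈ F)
    (hc : ∀ F ∈ Finset.powersetCard (k + 1) (Finset.univ : Finset (Fin (k + l + 1))),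
      ∀ v ∈ F, Function.Injective (c F v) ∧
        ∀ j, c F v j ∈ insert v (Finset.univ \ F))
    (hcompat : ∀ F ∈ Finset.powersetCard (k + 1) (Finset.univ : Finset (Fin (k + l + 1))),
      ∀ v ∈ F, ∃ (ρ : Equiv.Perm (Fin (k + l + 1))) (s : Equiv.Perm (Fin (k + 1)))
        (s' : Equiv.Perm (Fin (l + 1))),
          ρ ⟨k, by omega⟩ = v ∧
          (∀ i : Fin (k + 1), ρ ⟨(i : ℕ), by have := i.isLt; omega⟩ = a F (s i)) ∧
          (∀ j : Fin (l + 1), ρ ⟨k + (j : ℕ), by have := j.isLt; omega⟩ = c F v (s' j)) ∧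
          Equiv.Perm.sign ρ * Equiv.Perm.sign s * Equiv.Perm.sign s' = 1) :
    wedge k l α β σ =
      (1 / (Nat.choose (k + l + 1) (k + 1) : ℝ)) *
        ∑ F ∈ Finset.powersetCard (k + 1) (Finset.univ : Finset (Fin (k + l + 1))),
          α (σ ∘ a F) * ((1 / (k + 1 : ℝ)) * ∑ v ∈ F, β (σ ∘ c F v)) := by
  set T := (Finset.powersetCard (k + 1)
    (Finset.univ : Finset (Fin (k + l + 1)))).sigma fun F => F with hT
  have hflag : ∀ p ∈ T, ∃ ρ : Equiv.Perm (Fin (k + l + 1)), frontFlag k l ρ = p ∧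
      ((Equiv.Perm.sign ρ : ℤ) : ℝ) * cup k l α β (σ ∘ ρ) =
        α (σ ∘ a p.1) * β (σ ∘ c p.1 p.2) := by
    rintro ⟨F, v⟩ hp
    obtain ⟨hF, hv⟩ := Finset.mem_sigma.1 hp
    obtain ⟨ρ, s, t, hρ, hs, ht, hsign⟩ := hcompat F hF v hv
    refine ⟨ρ, ?_, sign_mul_cup_eq_of_compat hα hβ σ hs ht hsign⟩
    have hsub : (Finset.Iic (⟨k, by omega⟩ : Fin (k + l + 1))).map ρ.toEmbedding ⊆ F := by
      intro x hx
      obtain ⟨i, hi, rfl⟩ := Finset.mem_map.1 hx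
      have hik : (i : ℕ) ≤ k := Fin.le_def.1 (Finset.mem_Iic.1 hi)
      have := (ha F hF).2 (s ⟨i, by omega⟩)
      rwa [← hs] at this
    have hcard := (Finset.mem_powersetCard.1 hF).2
    simp only [frontFlag, hρ]
    rw [Finset.eq_of_subset_of_card_le hsub (by simp [hcard])]
  obtain ⟨N, hN⟩ : ∃ N : ℕ, ∀ p ∈ T,
      (Finset.univ.filter fun τ => frontFlag k l τ = p).card = N := by
    refine ⟨(Finset.univ.filter fun τ => frontFlag k l τ = frontFlag k l 1).card, fun p hp => ?_⟩
    obtain ⟨ρ, rfl, -⟩ := hflag p hp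
    exact card_frontFlag_fiber ρ 1
  have hTcard : T.card = (k + l + 1).choose (k + 1) * (k + 1) := by
    rw [hT, Finset.card_sigma, Finset.sum_congr rfl fun F hF => (Finset.mem_powersetCard.1 hF).2]
    simp
  have hcount : (k + l + 1).factorial = (k + l + 1).choose (k + 1) * (k + 1) * N := by
    have h := Finset.card_eq_sum_card_fiberwise (s := Finset.univ) (t := T)
      (f := frontFlag k l) (fun τ _ => frontFlag_mem τ)
    rw [Finset.sum_congr rfl hN, Finset.sum_const, hTcard, Finset.card_univ,
      Fintype.card_perm, Fintype.card_fin, smul_eq_mul] at h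
    exact h
  have hsum : ∑ τ : Equiv.Perm (Fin (k + l + 1)),
      ((Equiv.Perm.sign τ : ℤ) : ℝ) * cup k l α β (σ ∘ τ) =
        N * ∑ F ∈ Finset.powersetCard (k + 1) (Finset.univ : Finset (Fin (k + l + 1))),
          ∑ v ∈ F, α (σ ∘ a F) * β (σ ∘ c F v) := by
    rw [Finset.sum_sigma', ← Finset.sum_fiberwise_of_maps_to (t := T) (g := frontFlag k l)
      (fun τ _ => frontFlag_mem τ), Finset.mul_sum]
    refine Finset.sum_congr rfl fun p hp => ?_
    obtain ⟨ρ, hρ, hval⟩ := hflag p hp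
    rw [← hval, ← hN p hp, ← nsmul_eq_mul]
    refine Finset.sum_eq_card_nsmul fun τ hτ => ?_
    exact sign_mul_cup_eq_of_frontFlag_eq hα hβ σ ((Finset.mem_filter.1 hτ).2.trans hρ.symm)
  have hne : ((k + l + 1).factorial : ℝ) ≠ 0 := by positivity
  have hcast : ((k + l + 1).factorial : ℝ) = (k + l + 1).choose (k + 1) * (k + 1) * N := by
    exact_mod_cast hcount
  rw [wedge, hsum, hcast]
  rw [hcast] at hne
  have hN₀ : (N : ℝ) ≠ 0 := right_ne_zero_of_mul hne
  have hC₀ : ((k + l + 1).choose (k + 1) : ℝ) ≠ 0 :=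
    left_ne_zero_of_mul (left_ne_zero_of_mul hne)
  have hk₀ : (k + 1 : ℝ) ≠ 0 := right_ne_zero_of_mul (left_ne_zero_of_mul hne)
  simp only [Finset.mul_sum]
  refine Finset.sum_congr rfl fun F _ => Finset.sum_congr rfl fun v _ => ?_
  field_simp
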